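/- Let ρ ∈ 𝕊^m(ℝⁿ;𝒜_θ), m ∈ ℝ, and let χ ∈ 𝒮(ℝⁿ) (scalar-valued Schwartz function) with χ(0) = 1; for 0 < ε ≤ 1 set ρ_ε(ξ) = χ(εξ)ρ(ξ). Then each ρ_ε belongs to 𝒮(ℝⁿ;𝒜_θ), the family (ρ_ε)_{0<ε≤1} is bounded in 𝕊^m(ℝⁿ;𝒜_θ) (i.e. sup_{0<ε≤1} p_N^{(m)}(ρ_ε) < ∞ for every N ∈ ℕ₀), and for every m' > m one has p_N^{(m')}(ρ_ε − ρ) → 0 as ε → 0⁺ for all N, i.e. ρ_ε → ρ in 𝕊^{m'}(ℝⁿ;𝒜_θ). -/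

import Mathlib

open Complex Filter Topology
open scoped ComplexOrder Real BigOperators

noncomputable section

/-- Euclidean space `ℝⁿ`. -/
abbrev Rn (n : ℕ) : Type := EuclideanSpace ℝ (Fin n)

/-- `ℝⁿ × ℝⁿ`. -/
abbrev R2n (n : ℕ) : Type := Rn n × Rn n

/-- Length `|β|` of a multi-order `β ∈ ℕ₀ⁿ`. -/
def mdeg {n : ℕ} (b : Fin n → ℕ) : ℕ := ∑ j, b j

/-- Composition of a list of self-maps. -/
def compList {X : Type*} (l : List (X → X)) : X → X := l.foldr (· ∘ ·) id

/-- The phase `c(k,l) = Σ_{q<p} k_p θ_{pq} l_q`. -/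
def cPhase {n : ℕ} (θ : Matrix (Fin n) (Fin n) ℝ) (k l : Fin n → ℤ) : ℝ :=
  ∑ p, ∑ q, if q < p then (k p : ℝ) * θ p q * (l q : ℝ) else 0

/-- Euclidean norm `|k|` of a lattice point `k ∈ ℤⁿ`. -/
def znorm {n : ℕ} (k : Fin n → ℤ) : ℝ := Real.sqrt (∑ j, ((k j : ℝ)) ^ 2)

/-- `k^β = ∏ k_jᵝ`. -/
def kpow {n : ℕ} (b : Fin n → ℕ) (k : Fin n → ℤ) : ℝ := ∏ j, ((k j : ℝ)) ^ (b j)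

/-- A lattice point `k ∈ ℤⁿ` viewed as a point of `ℝⁿ`. -/
def zEmb {n : ℕ} (k : Fin n → ℤ) : Rn n := (WithLp.equiv 2 (Fin n → ℝ)).symm (fun j => (k j : ℝ))

variable {n : ℕ} {A : Type} [NormedRing A] [StarRing A] [CStarRing A]
  [NormedAlgebra ℂ A] [StarModule ℂ A] [CompleteSpace A]

/-- The derivation `δ_j u = (1/i) ∂_{s_j} α_s(u)|_{s=0}`. -/
def δd (αa : Rn n → (A ≃⋆ₐ[ℂ] A)) (j : Fin n) (u : A) : A :=
  (-Complex.I) • fderiv ℝ (fun s : Rn n => αa s u) 0 (EuclideanSpace.single j 1)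

/-- `δ^β = δ_1^{β_1} ⋯ δ_n^{β_n}`. -/
def δpow (αa : Rn n → (A ≃⋆ₐ[ℂ] A)) (b : Fin n → ℕ) : A → A :=
  compList (List.ofFn fun j => (δd αa j)^[b j])

/-- The smooth noncommutative torus `𝒜_θ`: elements with `C^∞` orbit map. -/
def SmoothSet (αa : Rn n → (A ≃⋆ₐ[ℂ] A)) : Set A :=
  {u | ∀ N : ℕ, ContDiff ℝ N (fun s : Rn n => αa s u)}

/-- `A_θ^{(N)}`: elements with `C^N` orbit map. -/
def CNSet (αa : Rn n → (A ≃⋆ₐ[ℂ] A)) (N : ℕ) : Set A :=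
  {u | ContDiff ℝ N (fun s : Rn n => αa s u)}

/-- The Fréchet seminorms `‖u‖_{(N)} = sup_{|β| ≤ N} ‖δ^β(u)‖` of `𝒜_θ`. -/
def frSemi (αa : Rn n → (A ≃⋆ₐ[ℂ] A)) (N : ℕ) (u : A) : ℝ :=
  ⨆ b : {b : Fin n → ℕ // mdeg b ≤ N}, ‖δpow αa b.1 u‖

/-- Partial derivative `∂_{ξ_j}` of maps `ℝⁿ → A`. -/
def pd {n : ℕ} (j : Fin n) (f : Rn n → A) : Rn n → A :=
  fun ξ => fderiv ℝ f ξ (EuclideanSpace.single j 1)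

/-- Iterated partial derivative `∂_ξ^β` of maps `ℝⁿ → A`. -/
def pdPow {n : ℕ} (b : Fin n → ℕ) : (Rn n → A) → (Rn n → A) :=
  compList (List.ofFn fun j => (pd j)^[b j])

/-- Partial derivative `∂_{s_j}` (first variable) of maps `ℝⁿ×ℝⁿ → A`. -/
def pdS {n : ℕ} (j : Fin n) (f : R2n n → A) : R2n n → A :=
  fun x => fderiv ℝ f x (EuclideanSpace.single j 1, 0)

/-- Partial derivative `∂_{ξ_j}` (second variable) of maps `ℝⁿ×ℝⁿ → A`. -/
def pdXi {n : ℕ} (j : Fin n) (f : R2n n → A) : R2n n → A :=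
  fun x => fderiv ℝ f x (0, EuclideanSpace.single j 1)

/-- `∂_s^β`. -/
def pdSPow {n : ℕ} (b : Fin n → ℕ) : (R2n n → A) → (R2n n → A) :=
  compList (List.ofFn fun j => (pdS j)^[b j])

/-- `∂_ξ^γ`. -/
def pdXiPow {n : ℕ} (b : Fin n → ℕ) : (R2n n → A) → (R2n n → A) :=
  compList (List.ofFn fun j => (pdXi j)^[b j])

/-- Forward difference operator `Δ_j` on maps `ℝⁿ → A`. -/
def fdiff {n : ℕ} (j : Fin n) (f : Rn n → A) : Rn n → A :=
  fun ξ => f (ξ + EuclideanSpace.single j 1) - f ξ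

/-- `Δ^β` on maps `ℝⁿ → A`. -/
def fdiffPow {n : ℕ} (b : Fin n → ℕ) : (Rn n → A) → (Rn n → A) :=
  compList (List.ofFn fun j => (fdiff j)^[b j])

/-- Forward difference operator `Δ_j` on sequences `ℤⁿ → A`. -/
def zdiff {n : ℕ} (j : Fin n) (f : (Fin n → ℤ) → A) : (Fin n → ℤ) → A :=
  fun k => f (k + Pi.single j 1) - f k

/-- `Δ^β` on sequences `ℤⁿ → A`. -/
def zdiffPow {n : ℕ} (b : Fin n → ℕ) : ((Fin n → ℤ) → A) → ((Fin n → ℤ) → A) :=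
  compList (List.ofFn fun j => (zdiff j)^[b j])

/-- The symbol class `𝕊^m(ℝⁿ; 𝒜_θ)`. -/
def IsSymbol (αa : Rn n → (A ≃⋆ₐ[ℂ] A)) (m : ℝ) (ρ : Rn n → A) : Prop :=
  (∀ ξ, ρ ξ ∈ SmoothSet αa) ∧
  (∀ a : Fin n → ℕ, ∀ N : ℕ, ContDiff ℝ N fun ξ => δpow αa a (ρ ξ)) ∧
  (∀ a b : Fin n → ℕ, ∃ C > 0, ∀ ξ,
    ‖δpow αa a (pdPow b ρ ξ)‖ ≤ C * (1 + ‖ξ‖) ^ (m - (mdeg b : ℝ)))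

/-- The class `𝒮(ℝⁿ; 𝒜_θ) = ∩ₘ 𝕊^m(ℝⁿ; 𝒜_θ)`. -/
def IsSchwartzSym (αa : Rn n → (A ≃⋆ₐ[ℂ] A)) (ρ : Rn n → A) : Prop :=
  ∀ m : ℝ, IsSymbol αa m ρ

/-- The seminorm `p_N^{(m)}` on `𝕊^m(ℝⁿ; 𝒜_θ)`. -/
def pSemi (αa : Rn n → (A ≃⋆ₐ[ℂ] A)) (m : ℝ) (N : ℕ) (ρ : Rn n → A) : ℝ :=
  ⨆ q : {ab : (Fin n → ℕ) × (Fin n → ℕ) // mdeg ab.1 + mdeg ab.2 ≤ N} × Rn n,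
    (1 + ‖q.2‖) ^ (-m + (mdeg q.1.1.2 : ℝ)) * ‖δpow αa q.1.1.1 (pdPow q.1.1.2 ρ q.2)‖

/-- The amplitude class `A^m(ℝⁿ×ℝⁿ; 𝒜_θ)`. -/
def IsAmplitude (αa : Rn n → (A ≃⋆ₐ[ℂ] A)) (m : ℝ) (a : R2n n → A) : Prop :=
  (∀ x, a x ∈ SmoothSet αa) ∧
  (∀ c : Fin n → ℕ, ∀ N : ℕ, ContDiff ℝ N fun x => δpow αa c (a x)) ∧
  (∀ c b g : Fin n → ℕ, ∃ C > 0, ∀ x : R2n n,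
    ‖δpow αa c (pdSPow b (pdXiPow g a) x)‖ ≤ C * (1 + ‖x.1‖ + ‖x.2‖) ^ m)

/-- The seminorm `q_N^{(m)}` on `A^m(ℝⁿ×ℝⁿ; 𝒜_θ)`. -/
def qSemi (αa : Rn n → (A ≃⋆ₐ[ℂ] A)) (m : ℝ) (N : ℕ) (a : R2n n → A) : ℝ :=
  ⨆ q : {t : (Fin n → ℕ) × (Fin n → ℕ) × (Fin n → ℕ) //
      mdeg t.1 + mdeg t.2.1 + mdeg t.2.2 ≤ N} × R2n n,
    (1 + ‖q.2.1‖ + ‖q.2.2‖) ^ (-m) *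
      ‖δpow αa q.1.1.1 (pdSPow q.1.1.2.1 (pdXiPow q.1.1.2.2 a) q.2)‖

/-- The toroidal symbol class `𝕊^m(ℤⁿ; 𝒜_θ)`. -/
def IsToroidal (αa : Rn n → (A ≃⋆ₐ[ℂ] A)) (m : ℝ) (ρ : (Fin n → ℤ) → A) : Prop :=
  (∀ k, ρ k ∈ SmoothSet αa) ∧
  (∀ a b : Fin n → ℕ, ∃ C > 0, ∀ k,
    ‖δpow αa a (zdiffPow b ρ k)‖ ≤ C * (1 + znorm k) ^ (m - (mdeg b : ℝ)))

/-- The coefficient `(1-χ)/(|s|²+|ξ|²)` of the operator `L`. -/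
def Lcoef {n : ℕ} (χc : R2n n → ℝ) (x : R2n n) : ℝ := (1 - χc x) / (‖x.1‖ ^ 2 + ‖x.2‖ ^ 2)

/-- The transpose `L^t` of `L = χ + (1-χ)(|s|²+|ξ|²)^{-1} Σ (ξ_j D_{s_j} + s_j D_{ξ_j})`,
namely `L^t u = χ u - Σ_j (D_{s_j}((1-χ)(|s|²+|ξ|²)^{-1} ξ_j u) + D_{ξ_j}(… s_j u))`. -/
def Ltrans (χc : R2n n → ℝ) (u : R2n n → A) : R2n n → A := fun x =>
  χc x • u x -
    ∑ j, ((-Complex.I) • pdS j (fun y => (Lcoef χc y * y.2 j) • u y) x +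
      (-Complex.I) • pdXi j (fun y => (Lcoef χc y * y.1 j) • u y) x)

/-- The (regularized) oscillating integral `(2π)^{-n} ∬ e^{is·ξ} (L^t)^N[a(s,ξ)] ds dξ`. -/
def Josc (χc : R2n n → ℝ) (N : ℕ) (a : R2n n → A) : A :=
  ((2 * Real.pi) ^ n)⁻¹ •
    MeasureTheory.integral MeasureTheory.volume
      (fun x : R2n n => Complex.exp (Complex.I * ((∑ j, x.1 j * x.2 j : ℝ) : ℂ)) •
        ((Ltrans χc)^[N] a) x)

/-- A convenient integer `> m + 2n`. -/
def Nfor (n : ℕ) (m : ℝ) : ℕ := ⌈m⌉₊ + 2 * n + 1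

set_option linter.unusedSectionVars false

section FoldOperators

variable {ι X : Type*}

theorem compList_map_iterate_apply (T : ι → X → X) (b : ι → ℕ) (l : List ι) (x : X) :
    compList (l.map fun j => (T j)^[b j]) x =
      (l.flatMap fun j => List.replicate (b j) j).foldr T x := by
  induction l with
  | nil => rfl
  | cons j l ih =>
    have hrep : ∀ (k : ℕ) (y : X), (List.replicate k j).foldr T y = (T j)^[k] y := by
      intro k y
      induction k with
      | zero => rfl
      | succ k ihk => rw [Function.iterate_succ_apply', ← ihk]; rfl
    rw [List.flatMap_cons, List.foldr_append, ← ih, hrep]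
    rfl

theorem foldr_mem_of_stable {T : ι → X → X} {S : Set X} (hS : ∀ j, ∀ x ∈ S, T j x ∈ S)
    (w : List ι) {x : X} (hx : x ∈ S) : w.foldr T x ∈ S := by
  induction w with
  | nil => exact hx
  | cons j w ih => exact hS j _ ih

theorem foldr_eq_of_perm {T : ι → X → X} {S : Set X} (hS : ∀ j, ∀ x ∈ S, T j x ∈ S)
    (hT : ∀ j k, ∀ x ∈ S, T j (T k x) = T k (T j x)) {v w : List ι} (h : v.Perm w)
    {x : X} (hx : x ∈ S) : v.foldr T x = w.foldr T x := by
  induction h with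
  | nil => rfl
  | cons j _ ih => simp only [List.foldr_cons, ih]
  | swap j k l => exact hT _ _ _ (foldr_mem_of_stable hS l hx)
  | trans _ _ ih₁ ih₂ => exact ih₁.trans ih₂

/-- The nondecreasing word in which the letter `j` occurs `b j` times. -/
def orderedWord {n : ℕ} (b : Fin n → ℕ) : List (Fin n) :=
  (List.finRange n).flatMap fun j => List.replicate (b j) j

theorem length_orderedWord {n : ℕ} (b : Fin n → ℕ) : (orderedWord b).length = mdeg b := by
  simp [orderedWord, mdeg, List.length_flatMap, ← List.ofFn_eq_map, List.sum_ofFn]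

theorem perm_orderedWord {n : ℕ} (w : List (Fin n)) :
    w.Perm (orderedWord fun j => w.count j) := by
  rw [List.perm_iff_count]
  intro k
  simp only [orderedWord, List.count_flatMap, Function.comp_def, List.count_replicate,
    ← List.ofFn_eq_map, List.sum_ofFn, beq_iff_eq]
  simp

theorem compList_ofFn_iterate_apply {n : ℕ} (T : Fin n → X → X) (b : Fin n → ℕ) (x : X) :
    compList (List.ofFn fun j => (T j)^[b j]) x = (orderedWord b).foldr T x := by
  rw [List.ofFn_eq_map, compList_map_iterate_apply]
  rfl

end FoldOperators

section PartialDerivatives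

open scoped ContDiff

theorem contDiff_pd {f : Rn n → A} (hf : ContDiff ℝ ∞ f) (j : Fin n) :
    ContDiff ℝ ∞ (pd j f) :=
  (hf.fderiv_right (m := ∞) (by simp)).clm_apply contDiff_const

theorem pd_comm {f : Rn n → A} (hf : ContDiff ℝ ∞ f) (j k : Fin n) :
    pd j (pd k f) = pd k (pd j f) := by
  have h1 : Differentiable ℝ (fderiv ℝ f) :=
    (hf.fderiv_right (m := ∞) (by simp)).differentiable (by simp)
  have h2 : ∀ (i l : Fin n) (ξ : Rn n), pd i (pd l f) ξ =
      fderiv ℝ (fderiv ℝ f) ξ (EuclideanSpace.single i 1) (EuclideanSpace.single l 1) := by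
    intro i l ξ
    change fderiv ℝ (fun η => fderiv ℝ f η (EuclideanSpace.single l 1)) ξ _ = _
    rw [fderiv_clm_apply (h1 ξ) (differentiableAt_const _)]
    simp
  ext ξ
  rw [h2, h2]
  exact (contDiff_infty.1 hf 2).contDiffAt.isSymmSndFDerivAt (by simp) _ _

theorem contDiff_foldr_pd {f : Rn n → A} (hf : ContDiff ℝ ∞ f) (w : List (Fin n)) :
    ContDiff ℝ ∞ (w.foldr pd f) :=
  foldr_mem_of_stable (S := {g : Rn n → A | ContDiff ℝ ∞ g}) (fun j _ hg => contDiff_pd hg j) w hf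

theorem pdPow_eq_foldr (b : Fin n → ℕ) (f : Rn n → A) :
    pdPow b f = (orderedWord b).foldr pd f :=
  compList_ofFn_iterate_apply pd b f

theorem foldr_pd_eq_pdPow {f : Rn n → A} (hf : ContDiff ℝ ∞ f) (w : List (Fin n)) :
    w.foldr pd f = pdPow (fun j => w.count j) f := by
  rw [pdPow_eq_foldr]
  exact foldr_eq_of_perm (S := {g : Rn n → A | ContDiff ℝ ∞ g})
    (fun j _ hg => contDiff_pd hg j) (fun j k _ hg => pd_comm hg j k) (perm_orderedWord w) hf

theorem pd_add {f g : Rn n → A} (hf : ContDiff ℝ ∞ f) (hg : ContDiff ℝ ∞ g) (j : Fin n) :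
    pd j (f + g) = pd j f + pd j g := by
  ext ξ
  simp [pd, fderiv_add (hf.differentiable (by simp) ξ) (hg.differentiable (by simp) ξ)]

theorem foldr_pd_add {f g : Rn n → A} (hf : ContDiff ℝ ∞ f) (hg : ContDiff ℝ ∞ g)
    (w : List (Fin n)) : w.foldr pd (f + g) = w.foldr pd f + w.foldr pd g := by
  induction w with
  | nil => rfl
  | cons j w ih =>
    simp only [List.foldr_cons, ih]
    exact pd_add (contDiff_foldr_pd hf w) (contDiff_foldr_pd hg w) j

theorem pd_smul {f : Rn n → ℂ} {g : Rn n → A} (hf : ContDiff ℝ ∞ f) (hg : ContDiff ℝ ∞ g)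
    (j : Fin n) :
    pd j (fun ξ => f ξ • g ξ) =
      (fun ξ => fderiv ℝ f ξ (EuclideanSpace.single j 1) • g ξ) + fun ξ => f ξ • pd j g ξ := by
  ext ξ
  have := fderiv_fun_smul (𝕜 := ℝ) (hf.differentiable (by simp) ξ) (hg.differentiable (by simp) ξ)
  simp [pd, this, add_comm]

/-- Leibniz estimate for the product of a scalar symbol of order `μ` and a symbol of order `m`,
with a constant depending only on the second factor. -/
theorem exists_norm_foldr_pd_smul_le (w : List (Fin n)) :
    ∀ (m : ℝ) (g : Rn n → A), ContDiff ℝ ∞ g →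
      (∀ v : List (Fin n), ∃ C, ∀ ξ, ‖v.foldr pd g ξ‖ ≤ C * (1 + ‖ξ‖) ^ (m - v.length)) →
      ∃ C : ℝ, 0 ≤ C ∧ ∀ (f : Rn n → ℂ) (K μ : ℝ), ContDiff ℝ ∞ f → 0 ≤ K →
        (∀ k ≤ w.length, ∀ ξ, ‖iteratedFDeriv ℝ k f ξ‖ ≤ K * (1 + ‖ξ‖) ^ (μ - k)) →
        ∀ ξ, ‖w.foldr pd (fun η => f η • g η) ξ‖ ≤
          C * K * (1 + ‖ξ‖) ^ (μ + m - w.length) := by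
  induction w using List.reverseRecOn with
  | nil =>
    intro m g hg hgb
    obtain ⟨C, hC⟩ := hgb []
    refine ⟨|C|, abs_nonneg _, fun f K μ hf hK hfb ξ => ?_⟩
    have h1 := hfb 0 le_rfl ξ
    have h2 := hC ξ
    have hp : 0 < 1 + ‖ξ‖ := by positivity
    simp only [norm_iteratedFDeriv_zero, Nat.cast_zero, sub_zero, List.foldr_nil,
      List.length_nil] at h1 h2 ⊢
    rw [norm_smul, Real.rpow_add hp]
    calc ‖f ξ‖ * ‖g ξ‖ ≤ (K * (1 + ‖ξ‖) ^ μ) * (|C| * (1 + ‖ξ‖) ^ m) := by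
          gcongr
          exact h2.trans (by gcongr; exact le_abs_self C)
      _ = _ := by ring
  | append_singleton w j ih =>
    intro m g hg hgb
    obtain ⟨C₁, hC₁, h₁⟩ := ih m g hg hgb
    obtain ⟨C₂, hC₂, h₂⟩ := ih (m - 1) (pd j g) (contDiff_pd hg j) (by
      intro v
      obtain ⟨C, hC⟩ := hgb (v ++ [j])
      refine ⟨C, fun ξ => ?_⟩
      have := hC ξ
      simp only [List.foldr_append, List.foldr_cons, List.foldr_nil, List.length_append,
        List.length_cons, List.length_nil] at this
      push_cast at this
      convert this using 3
      ring)
    refine ⟨C₁ + C₂, by positivity, fun f K μ hf hK hfb ξ => ?_⟩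
    have hf' : ContDiff ℝ ∞ fun η => fderiv ℝ f η (EuclideanSpace.single j 1) :=
      (hf.fderiv_right (m := ∞) (by simp)).clm_apply contDiff_const
    have e₁ := h₁ _ K (μ - 1) hf' hK (by
      intro k hk η
      have hd : ContDiff ℝ ∞ (fderiv ℝ f) := hf.fderiv_right (m := ∞) (by simp)
      have := norm_iteratedFDeriv_clm_apply_const (c := EuclideanSpace.single j (1 : ℝ)) (n := k)
        (hd.contDiffAt (x := η)) (by exact_mod_cast le_top)
      rw [norm_iteratedFDeriv_fderiv] at this
      simp only [PiLp.norm_single, norm_one, one_mul] at this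
      refine this.trans ((hfb (k + 1) (by simpa using hk) η).trans_eq ?_)
      push_cast
      congr 2
      ring) ξ
    have e₂ := h₂ f K μ hf hK (fun k hk => hfb k (hk.trans (by simp))) ξ
    rw [List.foldr_append, List.foldr_cons, List.foldr_nil, pd_smul hf hg,
      foldr_pd_add (f := fun η => fderiv ℝ f η (EuclideanSpace.single j 1) • g η)
        (g := fun η => f η • pd j g η) (hf'.smul hg) (hf.smul (contDiff_pd hg j))]
    have x₁ : μ - 1 + m - (w.length : ℝ) = μ + m - ((w ++ [j]).length : ℝ) := by
      simp; ring
    have x₂ : μ + (m - 1) - (w.length : ℝ) = μ + m - ((w ++ [j]).length : ℝ) := by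
      simp; ring
    rw [x₁] at e₁
    rw [x₂] at e₂
    calc _ ≤ _ := norm_add_le _ _
      _ ≤ _ := add_le_add e₁ e₂
      _ = _ := by ring

end PartialDerivatives

section IsometricActions

open scoped ContDiff

/-- `αa` is an action of `ℝⁿ` by isometries. -/
structure IsIsometricAction (αa : Rn n → (A ≃⋆ₐ[ℂ] A)) : Prop where
  add_apply : ∀ s t (u : A), αa (s + t) u = αa s (αa t u)
  zero_apply : ∀ u : A, αa 0 u = u
  norm_apply : ∀ s (u : A), ‖αa s u‖ = ‖u‖

/-- The automorphism `αa s` as a real linear isometry. -/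
def actionIsometry {αa : Rn n → (A ≃⋆ₐ[ℂ] A)} (h : IsIsometricAction αa) (s : Rn n) :
    A →ₗᵢ[ℝ] A where
  toFun := αa s
  map_add' := map_add _
  map_smul' c u := by
    have := map_smul (αa s) (c : ℂ) u
    simpa using this
  norm_map' := h.norm_apply s

variable {αa : Rn n → (A ≃⋆ₐ[ℂ] A)}

theorem δd_smul (j : Fin n) (c : ℂ) (u : A) : δd αa j (c • u) = c • δd αa j u := by
  have : (fun s : Rn n => αa s (c • u)) = c • fun s : Rn n => αa s u := by
    ext s
    simp
  simp only [δd, this, fderiv_const_smul_field]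
  simp [smul_comm c]

theorem foldr_δd_smul (w : List (Fin n)) (c : ℂ) (u : A) :
    w.foldr (δd αa) (c • u) = c • w.foldr (δd αa) u := by
  induction w with
  | nil => rfl
  | cons j w ih => rw [List.foldr_cons, ih, δd_smul, List.foldr_cons]

theorem δd_sub {u v : A} (hu : DifferentiableAt ℝ (fun s : Rn n => αa s u) 0)
    (hv : DifferentiableAt ℝ (fun s : Rn n => αa s v) 0) (j : Fin n) :
    δd αa j (u - v) = δd αa j u - δd αa j v := by
  have : (fun s : Rn n => αa s (u - v)) = fun s : Rn n => αa s u - αa s v := by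
    ext s
    simp
  simp only [δd, this, fderiv_fun_sub hu hv]
  simp [sub_eq_add_neg]

theorem IsIsometricAction.hasFDerivAt (h : IsIsometricAction αa) {u : A} {L : Rn n →L[ℝ] A}
    (hu : HasFDerivAt (fun s : Rn n => αa s u) L 0) (s : Rn n) :
    HasFDerivAt (fun t : Rn n => αa t u)
      ((actionIsometry h s).toContinuousLinearMap.comp L) s := by
  have h1 : HasFDerivAt (fun t : Rn n => t - s) (ContinuousLinearMap.id ℝ (Rn n)) s :=
    (hasFDerivAt_id s).sub_const s
  have hu' : HasFDerivAt (fun t : Rn n => αa t u) L ((fun t : Rn n => t - s) s) := by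
    simpa using hu
  have h2 := (actionIsometry h s).toContinuousLinearMap.hasFDerivAt.comp s (HasFDerivAt.comp (f := fun t : Rn n => t - s) s hu' h1)
  refine h2.congr_of_eventuallyEq (Eventually.of_forall fun t => ?_)
  change αa t u = αa s (αa (t - s) u)
  rw [← h.add_apply, add_sub_cancel]

theorem IsIsometricAction.apply_δd (h : IsIsometricAction αa) {u : A}
    (hu : DifferentiableAt ℝ (fun s : Rn n => αa s u) 0) (s : Rn n) (j : Fin n) :
    αa s (δd αa j u) =
      (-Complex.I) • fderiv ℝ (fun t : Rn n => αa t u) s (EuclideanSpace.single j 1) := by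
  rw [(h.hasFDerivAt hu.hasFDerivAt s).fderiv, δd, map_smul]
  rfl

/-- The derivative at the origin of an orbit map with prescribed values `v j` of the derivations. -/
def orbitDeriv (v : Fin n → A) : Rn n →L[ℝ] A :=
  ∑ j, (EuclideanSpace.proj j : Rn n →L[ℝ] ℝ).smulRight (Complex.I • v j)

theorem orbitDeriv_apply_single (v : Fin n → A) (j : Fin n) :
    orbitDeriv v (EuclideanSpace.single j 1) = Complex.I • v j := by
  simp [orbitDeriv]

theorem continuous_orbitDeriv : Continuous (orbitDeriv : (Fin n → A) → Rn n →L[ℝ] A) := by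
  have : ∀ j : Fin n, Continuous fun v : Fin n → A =>
      (EuclideanSpace.proj j : Rn n →L[ℝ] ℝ).smulRight (Complex.I • v j) := fun j =>
    (ContinuousLinearMap.smulRightL ℝ (Rn n) A (EuclideanSpace.proj j)).continuous.comp
      ((continuous_apply j).const_smul Complex.I)
  exact continuous_finsetSum _ fun j _ => this j

theorem orbitDeriv_δd {u : A} (hu : DifferentiableAt ℝ (fun s : Rn n => αa s u) 0) :
    HasFDerivAt (fun s : Rn n => αa s u) (orbitDeriv fun j => δd αa j u) 0 := by
  convert hu.hasFDerivAt using 1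
  apply ContinuousLinearMap.coe_injective
  refine (EuclideanSpace.basisFun (Fin n) ℝ).toBasis.ext fun j => ?_
  simp only [OrthonormalBasis.coe_toBasis, EuclideanSpace.basisFun_apply,
    ContinuousLinearMap.coe_coe, orbitDeriv_apply_single]
  simp [δd, smul_smul]

/-- The derivations `δ_1, …, δ_n` are jointly closed. -/
theorem IsIsometricAction.hasFDerivAt_of_tendsto (h : IsIsometricAction αa) {ι : Type*}
    {l : Filter ι} [l.NeBot] {u : ι → A} {u₀ : A} {v : Fin n → A}
    (hu : ∀ i, DifferentiableAt ℝ (fun s : Rn n => αa s (u i)) 0) (hlim : Tendsto u l (𝓝 u₀))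
    (hδ : ∀ j, Tendsto (fun i => δd αa j (u i)) l (𝓝 (v j))) :
    HasFDerivAt (fun s : Rn n => αa s u₀) (orbitDeriv v) 0 := by
  have hL : Tendsto (fun i => orbitDeriv fun j => δd αa j (u i)) l (𝓝 (orbitDeriv v)) :=
    (continuous_orbitDeriv.tendsto v).comp (tendsto_pi_nhds.2 hδ)
  have key := hasFDerivAt_of_tendstoLocallyUniformlyOn (𝕜 := ℝ) (l := l) (s := Set.univ)
    (f := fun i (s : Rn n) => αa s (u i)) (g := fun s => αa s u₀)
    (f' := fun i s =>
      (actionIsometry h s).toContinuousLinearMap.comp (orbitDeriv fun j => δd αa j (u i)))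
    (g' := fun s => (actionIsometry h s).toContinuousLinearMap.comp (orbitDeriv v))
    (x := 0) isOpen_univ ?_ (fun i s _ => h.hasFDerivAt (orbitDeriv_δd (hu i)) s) ?_
    (Set.mem_univ _)
  · have hz : (actionIsometry h 0).toContinuousLinearMap.comp (orbitDeriv v) = orbitDeriv v :=
      ContinuousLinearMap.ext fun x => h.zero_apply _
    rwa [hz] at key
  · refine TendstoUniformlyOn.tendstoLocallyUniformlyOn ?_
    rw [Metric.tendstoUniformlyOn_iff]
    intro ε hε
    filter_upwards [Metric.tendsto_nhds.1 hL ε hε] with i hi s _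
    rw [dist_eq_norm, ← ContinuousLinearMap.comp_sub,
      LinearIsometry.norm_toContinuousLinearMap_comp, ← dist_eq_norm, dist_comm]
    exact hi
  · intro s _
    exact ((actionIsometry h s).continuous.tendsto u₀).comp hlim

/-- A set of elements with differentiable orbits that is stable under the derivations consists
of smooth elements. -/
theorem IsIsometricAction.subset_smoothSet (h : IsIsometricAction αa) {T : Set A}
    (hT : ∀ u ∈ T, DifferentiableAt ℝ (fun s : Rn n => αa s u) 0)
    (hδ : ∀ u ∈ T, ∀ j, δd αa j u ∈ T) : T ⊆ SmoothSet αa := by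
  suffices H : ∀ (N : ℕ), ∀ u ∈ T, ContDiff ℝ N fun s : Rn n => αa s u from
    fun u hu N => H N u hu
  intro N
  induction N with
  | zero =>
    intro u hu
    exact contDiff_zero.2 (continuous_iff_continuousAt.2 fun s =>
      (h.hasFDerivAt (hT u hu).hasFDerivAt s).continuousAt)
  | succ N ih =>
    intro u hu
    have hd : Differentiable ℝ fun s : Rn n => αa s u := fun s =>
      (h.hasFDerivAt (hT u hu).hasFDerivAt s).differentiableAt
    have hf : fderiv ℝ (fun s : Rn n => αa s u) =
        fun s => orbitDeriv fun j => αa s (δd αa j u) := by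
      ext1 s
      rw [(h.hasFDerivAt (orbitDeriv_δd (hT u hu)) s).fderiv]
      apply ContinuousLinearMap.coe_injective
      refine (EuclideanSpace.basisFun (Fin n) ℝ).toBasis.ext fun j => ?_
      simp only [OrthonormalBasis.coe_toBasis, EuclideanSpace.basisFun_apply,
        ContinuousLinearMap.coe_coe, orbitDeriv_apply_single]
      change αa s (orbitDeriv _ _) = _
      rw [orbitDeriv_apply_single, map_smul]
    push_cast
    refine contDiff_succ_iff_fderiv.2 ⟨hd, by simp, ?_⟩
    rw [hf]
    refine ContDiff.sum fun j _ => ?_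
    exact (ContinuousLinearMap.smulRightL ℝ (Rn n) A (EuclideanSpace.proj j)).contDiff.comp
      ((ih _ (hδ u hu j)).const_smul Complex.I)

theorem contDiff_of_mem_smoothSet {u : A} (hu : u ∈ SmoothSet αa) :
    ContDiff ℝ ∞ fun s : Rn n => αa s u :=
  contDiff_infty.2 hu

theorem differentiableAt_of_mem_smoothSet {u : A} (hu : u ∈ SmoothSet αa) :
    DifferentiableAt ℝ (fun s : Rn n => αa s u) 0 :=
  (contDiff_of_mem_smoothSet hu).differentiable (by simp) 0

theorem smul_mem_smoothSet (c : ℂ) {u : A} (hu : u ∈ SmoothSet αa) : c • u ∈ SmoothSet αa := by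
  intro N
  simpa only [map_smul] using (hu N).const_smul c

theorem IsIsometricAction.orbit_δd (h : IsIsometricAction αa) {u : A} (hu : u ∈ SmoothSet αa)
    (j : Fin n) :
    (fun s : Rn n => αa s (δd αa j u)) = (-Complex.I) • pd j fun s : Rn n => αa s u :=
  funext fun s => h.apply_δd (differentiableAt_of_mem_smoothSet hu) s j

theorem IsIsometricAction.δd_mem_smoothSet (h : IsIsometricAction αa) (j : Fin n) (u : A)
    (hu : u ∈ SmoothSet αa) : δd αa j u ∈ SmoothSet αa := by
  refine contDiff_infty.1 ?_
  rw [h.orbit_δd hu]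
  exact (contDiff_pd (contDiff_of_mem_smoothSet hu) j).const_smul (-Complex.I)

theorem IsIsometricAction.δd_comm (h : IsIsometricAction αa) (j k : Fin n) (u : A)
    (hu : u ∈ SmoothSet αa) : δd αa j (δd αa k u) = δd αa k (δd αa j u) := by
  have key : ∀ i l : Fin n, δd αa i (δd αa l u) =
      (-Complex.I) • (-Complex.I) • pd i (pd l fun s : Rn n => αa s u) 0 := by
    intro i l
    rw [δd, h.orbit_δd hu, fderiv_const_smul_field]
    rfl
  rw [key, key, pd_comm (contDiff_of_mem_smoothSet hu)]

theorem δpow_eq_foldr (b : Fin n → ℕ) (u : A) :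
    δpow αa b u = (orderedWord b).foldr (δd αa) u :=
  compList_ofFn_iterate_apply (δd αa) b u

theorem IsIsometricAction.foldr_δd_eq_δpow (h : IsIsometricAction αa) {u : A}
    (hu : u ∈ SmoothSet αa) (w : List (Fin n)) :
    w.foldr (δd αa) u = δpow αa (fun j => w.count j) u := by
  rw [δpow_eq_foldr]
  exact foldr_eq_of_perm h.δd_mem_smoothSet h.δd_comm (perm_orderedWord w) hu

end IsometricActions

section SmoothMaps

open scoped ContDiff

variable {αa : Rn n → (A ≃⋆ₐ[ℂ] A)}

/-- Smooth maps `ℝⁿ → 𝒜_θ`. -/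
structure IsSmoothMap (αa : Rn n → (A ≃⋆ₐ[ℂ] A)) (ρ : Rn n → A) : Prop where
  mem : ∀ ξ, ρ ξ ∈ SmoothSet αa
  contDiff : ∀ w : List (Fin n), ContDiff ℝ ∞ fun ξ => w.foldr (δd αa) (ρ ξ)

theorem IsSymbol.isSmoothMap (h : IsIsometricAction αa) {m : ℝ} {ρ : Rn n → A}
    (hρ : IsSymbol αa m ρ) : IsSmoothMap αa ρ where
  mem := hρ.1
  contDiff w := by
    simp only [h.foldr_δd_eq_δpow (hρ.1 _)]
    exact contDiff_infty.2 (hρ.2.1 _)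

theorem IsSmoothMap.smul {ρ : Rn n → A} (hρ : IsSmoothMap αa ρ) {f : Rn n → ℂ}
    (hf : ContDiff ℝ ∞ f) : IsSmoothMap αa fun ξ => f ξ • ρ ξ where
  mem ξ := smul_mem_smoothSet _ (hρ.mem ξ)
  contDiff w := by
    simp only [foldr_δd_smul]
    exact hf.smul (hρ.contDiff w)

theorem tendsto_slope_pd {f : Rn n → A} (hf : ContDiff ℝ ∞ f) (j : Fin n) (ξ : Rn n) :
    Tendsto (fun t : ℝ => ((t⁻¹ : ℝ) : ℂ) • (f (ξ + t • EuclideanSpace.single j 1) - f ξ))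
      (𝓝[≠] 0) (𝓝 (pd j f ξ)) := by
  have := ((hf.differentiable (by simp) ξ).hasFDerivAt.hasLineDerivAt
    (EuclideanSpace.single j (1 : ℝ))).tendsto_slope_zero
  refine this.congr fun t => ?_
  rw [Complex.coe_smul]

theorem IsSmoothMap.hasFDerivAt_orbit_pd (h : IsIsometricAction αa) {ρ : Rn n → A}
    (hρ : IsSmoothMap αa ρ) (w : List (Fin n)) (j : Fin n) (ξ : Rn n) :
    HasFDerivAt (fun s : Rn n => αa s (pd j (fun η => w.foldr (δd αa) (ρ η)) ξ))
      (orbitDeriv fun k => pd j (fun η => (k :: w).foldr (δd αa) (ρ η)) ξ) 0 := by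
  have hd : ∀ η, DifferentiableAt ℝ (fun s : Rn n => αa s (w.foldr (δd αa) (ρ η))) 0 := fun η =>
    differentiableAt_of_mem_smoothSet (foldr_mem_of_stable h.δd_mem_smoothSet w (hρ.mem η))
  refine h.hasFDerivAt_of_tendsto (fun t => ?_) (tendsto_slope_pd (hρ.contDiff w) j ξ)
    fun k => ?_
  · simp only [map_smul, map_sub]
    exact ((hd _).sub (hd _)).const_smul ((t⁻¹ : ℝ) : ℂ)
  · simp only [δd_smul, δd_sub (hd _) (hd _)]
    exact tendsto_slope_pd (hρ.contDiff (k :: w)) j ξ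

theorem IsSmoothMap.δd_pd (h : IsIsometricAction αa) {ρ : Rn n → A}
    (hρ : IsSmoothMap αa ρ) (w : List (Fin n)) (j k : Fin n) (ξ : Rn n) :
    δd αa k (pd j (fun η => w.foldr (δd αa) (ρ η)) ξ) =
      pd j (fun η => (k :: w).foldr (δd αa) (ρ η)) ξ := by
  rw [δd, (hρ.hasFDerivAt_orbit_pd h w j ξ).fderiv, orbitDeriv_apply_single, smul_smul]
  simp

theorem IsSmoothMap.foldr_δd_pd (h : IsIsometricAction αa) {ρ : Rn n → A}
    (hρ : IsSmoothMap αa ρ) (w : List (Fin n)) (j : Fin n) (ξ : Rn n) :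
    w.foldr (δd αa) (pd j ρ ξ) = pd j (fun η => w.foldr (δd αa) (ρ η)) ξ := by
  induction w with
  | nil => rfl
  | cons k w ih => rw [List.foldr_cons, ih, hρ.δd_pd h]

theorem IsSmoothMap.pd (h : IsIsometricAction αa) {ρ : Rn n → A}
    (hρ : IsSmoothMap αa ρ) (j : Fin n) : IsSmoothMap αa (pd j ρ) where
  mem ξ := by
    refine h.subset_smoothSet (T := Set.range fun w : List (Fin n) =>
      _root_.pd j (fun η => w.foldr (δd αa) (ρ η)) ξ) ?_ ?_ ⟨[], rfl⟩
    · rintro _ ⟨w, rfl⟩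
      exact (hρ.hasFDerivAt_orbit_pd h w j ξ).differentiableAt
    · rintro _ ⟨w, rfl⟩ k
      exact ⟨k :: w, (hρ.δd_pd h w j k ξ).symm⟩
  contDiff w := by
    simp only [hρ.foldr_δd_pd h]
    exact contDiff_pd (hρ.contDiff w) j

theorem IsSmoothMap.foldr_pd (h : IsIsometricAction αa) {ρ : Rn n → A}
    (hρ : IsSmoothMap αa ρ) (v : List (Fin n)) : IsSmoothMap αa (v.foldr _root_.pd ρ) :=
  foldr_mem_of_stable (S := {σ : Rn n → A | IsSmoothMap αa σ}) (fun j _ hσ => hσ.pd h j) v hρ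

theorem IsSmoothMap.foldr_δd_foldr_pd (h : IsIsometricAction αa) {ρ : Rn n → A}
    (hρ : IsSmoothMap αa ρ) (w v : List (Fin n)) :
    (fun ξ => w.foldr (δd αa) (v.foldr _root_.pd ρ ξ)) =
      v.foldr _root_.pd fun ξ => w.foldr (δd αa) (ρ ξ) := by
  induction v with
  | nil => rfl
  | cons j v ih =>
    simp only [List.foldr_cons, ← ih]
    exact funext fun ξ => (hρ.foldr_pd h v).foldr_δd_pd h w j ξ

theorem IsSmoothMap.δpow_pdPow (h : IsIsometricAction αa) {ρ : Rn n → A}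
    (hρ : IsSmoothMap αa ρ) (a b : Fin n → ℕ) (ξ : Rn n) :
    δpow αa a (pdPow b ρ ξ) = pdPow b (fun η => δpow αa a (ρ η)) ξ := by
  simp only [δpow_eq_foldr, pdPow_eq_foldr]
  exact congrFun (hρ.foldr_δd_foldr_pd h _ _) ξ

end SmoothMaps

section SymbolEstimates

open scoped ContDiff

variable {αa : Rn n → (A ≃⋆ₐ[ℂ] A)}

theorem IsSymbol.exists_norm_δpow_pdPow_smul_le (h : IsIsometricAction αa) {m : ℝ} {ρ : Rn n → A}
    (hρ : IsSymbol αa m ρ) (a b : Fin n → ℕ) :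
    ∃ C : ℝ, 0 ≤ C ∧ ∀ (f : Rn n → ℂ) (K μ : ℝ), ContDiff ℝ ∞ f → 0 ≤ K →
      (∀ k ≤ mdeg b, ∀ ξ, ‖iteratedFDeriv ℝ k f ξ‖ ≤ K * (1 + ‖ξ‖) ^ (μ - k)) →
      ∀ ξ, ‖δpow αa a (pdPow b (fun η => f η • ρ η) ξ)‖ ≤
        C * K * (1 + ‖ξ‖) ^ (μ + m - mdeg b) := by
  have hs := hρ.isSmoothMap h
  have hcd : ContDiff ℝ ∞ fun ξ => δpow αa a (ρ ξ) := contDiff_infty.2 (hρ.2.1 a)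
  obtain ⟨C, hC, hb⟩ := exists_norm_foldr_pd_smul_le (orderedWord b) m _ hcd (by
    intro v
    obtain ⟨C, -, hC⟩ := hρ.2.2 a fun j => v.count j
    refine ⟨C, fun ξ => ?_⟩
    rw [foldr_pd_eq_pdPow hcd, ← hs.δpow_pdPow h, (perm_orderedWord v).length_eq,
      length_orderedWord]
    exact hC ξ)
  refine ⟨C, hC, fun f K μ hf hK hfb ξ => ?_⟩
  have := hb f K μ hf hK (by rwa [length_orderedWord]) ξ
  rw [(hs.smul hf).δpow_pdPow h, pdPow_eq_foldr]
  simp only [δpow_eq_foldr, foldr_δd_smul] at this ⊢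
  rwa [length_orderedWord] at this

theorem finite_mdeg_add_mdeg_le (N : ℕ) :
    Finite {ab : (Fin n → ℕ) × (Fin n → ℕ) // mdeg ab.1 + mdeg ab.2 ≤ N} := by
  have hle : ∀ (b : Fin n → ℕ) (j : Fin n), b j ≤ mdeg b := fun b j =>
    Finset.single_le_sum (fun _ _ => Nat.zero_le _) (Finset.mem_univ j)
  refine Set.Finite.subset ((Set.finite_Iic (fun _ : Fin n => N)).prod
    (Set.finite_Iic (fun _ : Fin n => N))) fun ab hab => ⟨fun j => ?_, fun j => ?_⟩
  · exact (hle ab.1 j).trans (le_trans (Nat.le_add_right _ _) hab)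
  · exact (hle ab.2 j).trans (le_trans (Nat.le_add_left _ _) hab)

theorem IsSymbol.exists_pSemi_smul_le (h : IsIsometricAction αa) {m : ℝ} {ρ : Rn n → A}
    (hρ : IsSymbol αa m ρ) (N : ℕ) :
    ∃ C : ℝ, 0 ≤ C ∧ ∀ (f : Rn n → ℂ) (K μ m' : ℝ), ContDiff ℝ ∞ f → 0 ≤ K → μ + m ≤ m' →
      (∀ k ≤ N, ∀ ξ, ‖iteratedFDeriv ℝ k f ξ‖ ≤ K * (1 + ‖ξ‖) ^ (μ - k)) →
      pSemi αa m' N (fun ξ => f ξ • ρ ξ) ≤ C * K := by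
  have := finite_mdeg_add_mdeg_le (n := n) N
  choose C hC hCb using fun ab : {ab : (Fin n → ℕ) × (Fin n → ℕ) // mdeg ab.1 + mdeg ab.2 ≤ N} =>
    hρ.exists_norm_δpow_pdPow_smul_le h ab.1.1 ab.1.2
  obtain ⟨M, hM⟩ := (Set.finite_range C).bddAbove
  refine ⟨max M 0, le_max_right _ _, fun f K μ m' hf hK hm hfb => ?_⟩
  refine Real.iSup_le ?_ (by positivity)
  rintro ⟨ab, ξ⟩
  have hp : 0 < 1 + ‖ξ‖ := by positivity
  have hCM : C ab ≤ max M 0 := (hM ⟨ab, rfl⟩).trans (le_max_left _ _)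
  have hle : mdeg ab.1.2 ≤ N := (Nat.le_add_left _ _).trans ab.2
  have key := hCb ab f K μ hf hK (fun k hk => hfb k (hk.trans hle)) ξ
  calc (1 + ‖ξ‖) ^ (-m' + (mdeg ab.1.2 : ℝ)) *
        ‖δpow αa ab.1.1 (pdPow ab.1.2 (fun η => f η • ρ η) ξ)‖
      ≤ (1 + ‖ξ‖) ^ (-m' + (mdeg ab.1.2 : ℝ)) *
        (max M 0 * K * (1 + ‖ξ‖) ^ (m' - mdeg ab.1.2)) := by
        gcongr
        refine key.trans ?_
        gcongr
        linarith [norm_nonneg ξ]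
    _ = max M 0 * K * ((1 + ‖ξ‖) ^ (-m' + (mdeg ab.1.2 : ℝ)) *
        (1 + ‖ξ‖) ^ (m' - mdeg ab.1.2)) := by ring
    _ = max M 0 * K := by
        rw [← Real.rpow_add hp]
        simp

theorem IsSymbol.smul (h : IsIsometricAction αa) {m : ℝ} {ρ : Rn n → A}
    (hρ : IsSymbol αa m ρ) {f : Rn n → ℂ} {μ m' : ℝ} (hf : ContDiff ℝ ∞ f) (hm : μ + m ≤ m')
    (hfb : ∀ N : ℕ, ∃ K : ℝ, 0 ≤ K ∧
      ∀ k ≤ N, ∀ ξ, ‖iteratedFDeriv ℝ k f ξ‖ ≤ K * (1 + ‖ξ‖) ^ (μ - k)) :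
    IsSymbol αa m' fun ξ => f ξ • ρ ξ := by
  refine ⟨fun ξ => smul_mem_smoothSet _ (hρ.1 ξ), fun a N => ?_, fun a b => ?_⟩
  · simp only [δpow_eq_foldr, foldr_δd_smul]
    simp only [← δpow_eq_foldr]
    exact (contDiff_infty.1 hf N).smul (hρ.2.1 a N)
  · obtain ⟨C, hC, hb⟩ := hρ.exists_norm_δpow_pdPow_smul_le h a b
    obtain ⟨K, hK, hKb⟩ := hfb (mdeg b)
    refine ⟨C * K + 1, by positivity, fun ξ => (hb f K μ hf hK hKb ξ).trans ?_⟩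
    gcongr
    · linarith
    · linarith [norm_nonneg ξ]

end SymbolEstimates

section ScaledCutoffs

open scoped ContDiff

theorem contDiff_schwartz_comp_smul (χ : SchwartzMap (Rn n) ℂ) (ε : ℝ) :
    ContDiff ℝ ∞ fun ξ => χ (ε • ξ) :=
  (χ.smooth ⊤).comp (contDiff_const_smul ε)

theorem exists_norm_iteratedFDeriv_schwartz_comp_smul_le (χ : SchwartzMap (Rn n) ℂ) (N Q : ℕ) :
    ∃ C : ℝ, 0 ≤ C ∧ ∀ ε : ℝ, 0 < ε → ε ≤ 1 → ∀ k ≤ N, ∀ s : ℝ, 0 ≤ s → s ≤ Q → ∀ ξ,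
      ‖iteratedFDeriv ℝ k (fun η => χ (ε • η)) ξ‖ ≤
        C * ε ^ ((k : ℝ) - s) * (1 + ‖ξ‖) ^ (-s) := by
  set C : ℝ := 2 ^ Q *
    ((Finset.Iic (Q, N)).sup fun p => SchwartzMap.seminorm ℝ p.1 p.2) χ with hCdef
  have hC : 0 ≤ C := by positivity
  refine ⟨C, hC, fun ε hε hε1 k hk s hs hsQ ξ => ?_⟩
  have hχ := SchwartzMap.one_add_le_sup_seminorm_apply (𝕜 := ℝ) (m := (Q, N)) (k := Q) (n := k)
    le_rfl hk χ (ε • ξ)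
  have hp : 0 < 1 + ‖ξ‖ := by positivity
  have hY : 1 ≤ 1 + ‖ε • ξ‖ := by linarith [norm_nonneg (ε • ξ)]
  have hXY : ε * (1 + ‖ξ‖) ≤ 1 + ‖ε • ξ‖ := by
    rw [norm_smul, Real.norm_of_nonneg hε.le]
    linarith
  have hbound : ‖iteratedFDeriv ℝ k χ (ε • ξ)‖ ≤ C * (ε * (1 + ‖ξ‖)) ^ (-s) := by
    calc ‖iteratedFDeriv ℝ k χ (ε • ξ)‖ ≤ C * (1 + ‖ε • ξ‖) ^ (-(Q : ℝ)) := by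
          rw [Real.rpow_neg (by positivity), Real.rpow_natCast, ← div_eq_mul_inv,
            le_div_iff₀ (by positivity), mul_comm]
          exact hχ
      _ ≤ C * (1 + ‖ε • ξ‖) ^ (-s) := by gcongr
      _ ≤ C * (ε * (1 + ‖ξ‖)) ^ (-s) := by
          refine mul_le_mul_of_nonneg_left ?_ hC
          exact Real.rpow_le_rpow_of_nonpos (by positivity) hXY (by linarith)
  rw [iteratedFDeriv_comp_const_smul ε (χ.smooth k), norm_smul, norm_pow,
    Real.norm_of_nonneg hε.le]
  calc ε ^ k * ‖iteratedFDeriv ℝ k χ (ε • ξ)‖ ≤ ε ^ k * (C * (ε * (1 + ‖ξ‖)) ^ (-s)) := by gcongr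
    _ = C * ε ^ ((k : ℝ) - s) * (1 + ‖ξ‖) ^ (-s) := by
        rw [Real.mul_rpow hε.le hp.le, sub_eq_add_neg, Real.rpow_add hε, Real.rpow_natCast]
        ring

/-- For `μ ≤ 0`, the scaled cut-offs satisfy symbol estimates of order `μ` with constants
`O(ε^μ)`. -/
theorem exists_norm_iteratedFDeriv_schwartz_comp_smul_le_of_nonpos (χ : SchwartzMap (Rn n) ℂ)
    (N : ℕ) {μ : ℝ} (hμ : μ ≤ 0) :
    ∃ C : ℝ, 0 ≤ C ∧ ∀ ε : ℝ, 0 < ε → ε ≤ 1 → ∀ k ≤ N, ∀ ξ,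
      ‖iteratedFDeriv ℝ k (fun η => χ (ε • η)) ξ‖ ≤
        C * ε ^ μ * (1 + ‖ξ‖) ^ (μ - k) := by
  obtain ⟨C, hC, hb⟩ := exists_norm_iteratedFDeriv_schwartz_comp_smul_le χ N (N + ⌈-μ⌉₊)
  refine ⟨C, hC, fun ε hε hε1 k hk ξ => ?_⟩
  have hkN : (k : ℝ) ≤ N := by exact_mod_cast hk
  have := hb ε hε hε1 k hk (k - μ) (by linarith [Nat.cast_nonneg (α := ℝ) k])
    (by push_cast; linarith [Nat.le_ceil (-μ)]) ξ
  simpa using this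

theorem exists_norm_schwartz_sub_one_le (χ : SchwartzMap (Rn n) ℂ) (hχ0 : χ 0 = 1) :
    ∃ C : ℝ, 0 ≤ C ∧ ∀ t : ℝ, 0 ≤ t → t ≤ 1 → ∀ y, ‖χ y - 1‖ ≤ C * ‖y‖ ^ t := by
  obtain ⟨C₀, hC₀⟩ := χ.decay 0 0
  obtain ⟨C₁, hC₁⟩ := χ.decay 0 1
  have hlip : ∀ y, ‖χ y - 1‖ ≤ C₁ * ‖y‖ := by
    intro y
    have := Convex.norm_image_sub_le_of_norm_fderiv_le (𝕜 := ℝ) (f := χ) (s := Set.univ)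
      (x := 0) (y := y) (C := C₁) (fun x _ => χ.differentiableAt) (fun x _ => by
        have := hC₁.2 x
        rwa [pow_zero, one_mul, norm_iteratedFDeriv_one] at this) convex_univ (Set.mem_univ _)
      (Set.mem_univ _)
    simpa [hχ0] using this
  have hbdd : ∀ y, ‖χ y - 1‖ ≤ C₀ + 1 := by
    intro y
    have := hC₀.2 y
    rw [pow_zero, one_mul, norm_iteratedFDeriv_zero] at this
    calc _ ≤ ‖χ y‖ + ‖(1 : ℂ)‖ := norm_sub_le _ _
      _ ≤ _ := by simpa using this
  refine ⟨C₁ + (C₀ + 1), by linarith [hC₀.1, hC₁.1], fun t ht ht1 y => ?_⟩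
  rcases le_total ‖y‖ 1 with hy | hy
  · calc ‖χ y - 1‖ ≤ C₁ * ‖y‖ := hlip y
      _ ≤ (C₁ + (C₀ + 1)) * ‖y‖ ^ t := by
        have hyt : ‖y‖ ≤ ‖y‖ ^ t := by
          rcases (norm_nonneg y).eq_or_lt with h0 | h0
          · rw [← h0]
            exact Real.rpow_nonneg le_rfl t
          · simpa using Real.rpow_le_rpow_of_exponent_ge h0 hy ht1
        have := hC₀.1
        have := hC₁.1
        gcongr
        linarith
  · calc ‖χ y - 1‖ ≤ (C₀ + 1) * 1 := by simpa using hbdd y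
      _ ≤ (C₁ + (C₀ + 1)) * ‖y‖ ^ t := by
        have := hC₀.1
        have := hC₁.1
        refine mul_le_mul (by linarith) (Real.one_le_rpow hy ht) zero_le_one (by linarith)

/-- For `0 ≤ t ≤ 1`, the functions `χ(ε·) - 1` satisfy symbol estimates of order `t` with constants
`O(ε^t)`. -/
theorem exists_norm_iteratedFDeriv_schwartz_comp_smul_sub_one_le (χ : SchwartzMap (Rn n) ℂ)
    (hχ0 : χ 0 = 1) (N : ℕ) {t : ℝ} (ht : 0 ≤ t) (ht1 : t ≤ 1) :
    ∃ C : ℝ, 0 ≤ C ∧ ∀ ε : ℝ, 0 < ε → ε ≤ 1 → ∀ k ≤ N, ∀ ξ,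
      ‖iteratedFDeriv ℝ k (fun η => χ (ε • η) - 1) ξ‖ ≤
        C * ε ^ t * (1 + ‖ξ‖) ^ (t - k) := by
  obtain ⟨C₁, hC₁, h₁⟩ := exists_norm_schwartz_sub_one_le χ hχ0
  obtain ⟨C₂, hC₂, h₂⟩ := exists_norm_iteratedFDeriv_schwartz_comp_smul_le χ N N
  refine ⟨C₁ + C₂, by positivity, fun ε hε hε1 k hk ξ => ?_⟩
  rcases Nat.eq_zero_or_pos k with rfl | hk0
  · have := h₁ t ht ht1 (ε • ξ)
    rw [norm_smul, Real.norm_of_nonneg hε.le, Real.mul_rpow hε.le (norm_nonneg _)] at this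
    rw [norm_iteratedFDeriv_zero, Nat.cast_zero, sub_zero]
    calc ‖χ (ε • ξ) - 1‖ ≤ C₁ * (ε ^ t * ‖ξ‖ ^ t) := this
      _ ≤ (C₁ + C₂) * (ε ^ t * (1 + ‖ξ‖) ^ t) := by
        gcongr
        · linarith
        · linarith
      _ = _ := by ring
  · have hk1 : (1 : ℝ) ≤ k := by exact_mod_cast hk0
    have hkN : (k : ℝ) ≤ N := by exact_mod_cast hk
    have := h₂ ε hε hε1 k hk (k - t) (by linarith) (by linarith) ξ
    have e : iteratedFDeriv ℝ k (fun η => χ (ε • η) - 1) ξ =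
        iteratedFDeriv ℝ k (fun η => χ (ε • η)) ξ := by
      have hadd := iteratedFDeriv_add_apply (x := ξ) (i := k) (g := fun _ => (-1 : ℂ))
        ((contDiff_infty.1 (contDiff_schwartz_comp_smul χ ε) k).contDiffAt) contDiffAt_const
      rw [iteratedFDeriv_const_of_ne hk0.ne', Pi.zero_apply, add_zero] at hadd
      rw [← hadd]
      simp only [sub_eq_add_neg, Pi.add_def]
    rw [e]
    refine this.trans ?_
    rw [sub_sub_cancel, neg_sub]
    gcongr
    linarith

end ScaledCutoffs

/-- Let `ρ ∈ 𝕊^m(ℝⁿ;𝒜_θ)` and `χ ∈ 𝒮(ℝⁿ)` with `χ(0) = 1`, and set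
`ρ_ε(ξ) = χ(εξ)ρ(ξ)` for `0 < ε ≤ 1`. Then each `ρ_ε` is in `𝒮(ℝⁿ;𝒜_θ)`, the family
`(ρ_ε)` is bounded in `𝕊^m(ℝⁿ;𝒜_θ)`, and `ρ_ε → ρ` in `𝕊^{m'}(ℝⁿ;𝒜_θ)` as `ε → 0⁺`
for every `m' > m`. -/
theorem statement_10
    {n : ℕ} (hn : 2 ≤ n)
    {A : Type} [NormedRing A] [StarRing A] [CStarRing A] [NormedAlgebra ℂ A]
    [StarModule ℂ A] [CompleteSpace A]
    (αa : Rn n → (A ≃⋆ₐ[ℂ] A))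
    (hαadd : ∀ s t (u : A), αa (s + t) u = αa s (αa t u))
    (hα0 : ∀ u : A, αa 0 u = u)
    (hαiso : ∀ s (u : A), ‖αa s u‖ = ‖u‖)
    (m : ℝ) (ρ : Rn n → A) (hρ : IsSymbol αa m ρ)
    (χ : SchwartzMap (Rn n) ℂ) (hχ0 : χ 0 = 1) :
    -- each `ρ_ε` is a Schwartz-class symbol
    (∀ ε : ℝ, 0 < ε → ε ≤ 1 →
      IsSchwartzSym αa (fun ξ => χ (ε • ξ) • ρ ξ)) ∧
    -- the family `(ρ_ε)_{0<ε≤1}` is bounded in `𝕊^m(ℝⁿ;𝒜_θ)`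
    (∀ N : ℕ, ∃ C : ℝ, ∀ ε : ℝ, 0 < ε → ε ≤ 1 →
      pSemi αa m N (fun ξ => χ (ε • ξ) • ρ ξ) ≤ C) ∧
    -- `ρ_ε → ρ` in `𝕊^{m'}(ℝⁿ;𝒜_θ)` as `ε → 0⁺`, for every `m' > m`
    (∀ m' : ℝ, m < m' → ∀ N : ℕ,
      Filter.Tendsto (fun ε : ℝ => pSemi αa m' N ((fun ξ => χ (ε • ξ) • ρ ξ) - ρ))
        (nhdsWithin 0 (Set.Ioi 0)) (nhds 0)) := by
  have h : IsIsometricAction αa := ⟨hαadd, hα0, hαiso⟩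
  refine ⟨fun ε hε hε1 m' => ?_, fun N => ?_, fun m' hm' N => ?_⟩
  · refine hρ.smul h (μ := min (m' - m) 0) (contDiff_schwartz_comp_smul χ ε)
      (by linarith [min_le_left (m' - m) 0]) fun N => ?_
    obtain ⟨C, hC, hb⟩ := exists_norm_iteratedFDeriv_schwartz_comp_smul_le_of_nonpos χ N
      (min_le_right (m' - m) 0)
    exact ⟨_, by positivity, hb ε hε hε1⟩
  · obtain ⟨C, hC, hb⟩ := hρ.exists_pSemi_smul_le h N
    obtain ⟨K, hK, hKb⟩ := exists_norm_iteratedFDeriv_schwartz_comp_smul_le_of_nonpos χ N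
      (le_refl (0 : ℝ))
    refine ⟨C * K, fun ε hε hε1 => ?_⟩
    exact hb _ K 0 m (contDiff_schwartz_comp_smul χ ε) hK (zero_add m).le
      (by simpa using hKb ε hε hε1)
  · set t : ℝ := min (m' - m) 1
    have ht : 0 < t := lt_min (by linarith) one_pos
    obtain ⟨C, hC, hb⟩ := hρ.exists_pSemi_smul_le h N
    obtain ⟨K, hK, hKb⟩ := exists_norm_iteratedFDeriv_schwartz_comp_smul_sub_one_le χ hχ0 N ht.le
      (min_le_right (m' - m) 1)
    have hlim : Tendsto (fun ε : ℝ => C * (K * ε ^ t)) (𝓝[>] 0) (𝓝 0) := by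
      have h0 : Tendsto (fun ε : ℝ => ε ^ t) (𝓝[>] 0) (𝓝 0) := by
        simpa [Real.zero_rpow ht.ne'] using
          ((Real.continuousAt_rpow_const 0 t (Or.inr ht.le)).tendsto.mono_left
            (nhdsWithin_le_nhds (s := Set.Ioi 0)))
      simpa using (h0.const_mul K).const_mul C
    refine squeeze_zero' (Eventually.of_forall fun ε => ?_) ?_ hlim
    · exact Real.iSup_nonneg fun q => by positivity
    · filter_upwards [Ioc_mem_nhdsGT (zero_lt_one' ℝ)] with ε hε
      have e : (fun ξ => χ (ε • ξ) • ρ ξ) - ρ = fun ξ => (χ (ε • ξ) - 1) • ρ ξ := by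
        ext ξ
        simp [sub_smul]
      rw [e]
      have hε0 : 0 < ε := hε.1
      exact hb _ (K * ε ^ t) t m' ((contDiff_schwartz_comp_smul χ ε).sub contDiff_const)
        (by positivity) (by linarith [min_le_left (m' - m) 1]) (hKb ε hε.1 hε.2)
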